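/- For every Boolean function f : {0,1}^n → {0,1}, bs(f) ≤ 2·deg(f)^2. -/

import Mathlib

open MvPolynomial Finset
open scoped Classical

/-- `bval` converts a boolean to the real number 0 or 1. -/
def bval (x : Bool) : ℝ := if x then 1 else 0

/-- `Represents P f` : `P` is the multilinear real polynomial representing the
Boolean function `f : {0,1}^n → {0,1}`. -/
def Represents {n : ℕ} (P : MvPolynomial (Fin n) ℝ) (f : (Fin n → Bool) → Bool) : Prop :=
  (∀ m ∈ P.support, ∀ i, m i ≤ 1) ∧
  ∀ x : Fin n → Bool, MvPolynomial.eval (fun i => bval (x i)) P = bval (f x)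

/-- Flip the `i`-th bit of `x`. -/
def flip1 {n : ℕ} (x : Fin n → Bool) (i : Fin n) : Fin n → Bool :=
  Function.update x i (!(x i))

/-- Coordinate `i` is relevant for `f`. -/
def Relevant {n : ℕ} (f : (Fin n → Bool) → Bool) (i : Fin n) : Prop :=
  ∃ x, f (flip1 x i) ≠ f x

/-- The set of relevant coordinates of `f`. -/
noncomputable def relSet {n : ℕ} (f : (Fin n → Bool) → Bool) : Finset (Fin n) :=
  Finset.univ.filter fun i => Relevant f i

/-- The influence of coordinate `i` on `f`. -/
noncomputable def influence {n : ℕ} (f : (Fin n → Bool) → Bool) (i : Fin n) : ℝ :=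
  ((Finset.univ.filter fun x => f (flip1 x i) ≠ f x).card : ℝ) / 2 ^ n

/-- `degI P i` : the maximal degree of a monomial of `P` containing `x i`. -/
noncomputable def degI {n : ℕ} (P : MvPolynomial (Fin n) ℝ) (i : Fin n) : ℕ :=
  (P.support.filter fun m => m i ≠ 0).sup fun m => m.sum fun _ e => e

/-- `W P f = Σ_{i ∈ R(f)} 2^{-deg_i(f)}`, computed via the representing polynomial `P`. -/
noncomputable def W {n : ℕ} (P : MvPolynomial (Fin n) ℝ) (f : (Fin n → Bool) → Bool) : ℝ :=
  ∑ i ∈ relSet f, ((2:ℝ) ^ degI P i)⁻¹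

/-- Flip the bits of `x` in the block `B`. -/
def flipB {n : ℕ} (x : Fin n → Bool) (B : Finset (Fin n)) : Fin n → Bool :=
  fun j => if j ∈ B then !(x j) else x j

/-- `f` has `b` pairwise disjoint sensitive blocks at some input. -/
def HasSensBlocks {n : ℕ} (f : (Fin n → Bool) → Bool) (b : ℕ) : Prop :=
  ∃ (x : Fin n → Bool) (B : Fin b → Finset (Fin n)),
    (∀ j k, j ≠ k → Disjoint (B j) (B k)) ∧ ∀ j, f (flipB x (B j)) ≠ f x

/-- The block sensitivity of `f`. -/
noncomputable def bs {n : ℕ} (f : (Fin n → Bool) → Bool) : ℕ :=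
  sSup {b | HasSensBlocks f b}

/-- Restriction of `f` fixing the coordinates in `H` according to `α`. -/
def restrict {n : ℕ} (f : (Fin n → Bool) → Bool) (H : Finset (Fin n)) (α : Fin n → Bool) :
    (Fin n → Bool) → Bool :=
  fun x => f fun i => if i ∈ H then α i else x i

/-- The multilinear monomial (exponent vector) with support `S`. -/
noncomputable def monOf {n : ℕ} (S : Finset (Fin n)) : Fin n →₀ ℕ :=
  ∑ j ∈ S, Finsupp.single j 1

/-- **Markov's inequality at an endpoint**: a real polynomial of degree at most `d` that maps
`[0, 1]` to itself has derivative at most `d ^ 2` in absolute value at `0`. -/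
lemma abs_derivative_eval_zero_le {p : Polynomial ℝ} {d : ℕ} (hd : p.natDegree ≤ d)
    (hp : ∀ t ∈ Set.Icc (0 : ℝ) 1, p.eval t ∈ Set.Icc (0 : ℝ) 1) :
    |p.derivative.eval 0| ≤ (d : ℝ) ^ 2 := by
  let ℓ : Polynomial ℝ := Polynomial.C (1 / 2) * (1 - Polynomial.X)
  have hℓ : ℓ.natDegree ≤ 1 := by
    refine Polynomial.natDegree_C_mul_le _ _ |>.trans ?_
    exact (Polynomial.natDegree_sub_le _ _).trans (by simp)
  have key : ∀ s : ℝ, |s| = 1 → -s * p.derivative.eval 0 ≤ (d : ℝ) ^ 2 := by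
    intro s hs
    let R : Polynomial ℝ := Polynomial.C s * (2 * p.comp ℓ - 1)
    have hRdeg : R.degree ≤ d := by
      refine Polynomial.degree_le_of_natDegree_le ?_
      refine (Polynomial.natDegree_C_mul_le _ _).trans ?_
      refine (Polynomial.natDegree_sub_le _ _).trans ?_
      refine max_le ?_ (by simp)
      refine (Polynomial.natDegree_mul_le).trans ?_
      have h1 : (p.comp ℓ).natDegree ≤ d :=
        Polynomial.natDegree_comp_le.trans (by nlinarith)
      have h2 : (2 : Polynomial ℝ).natDegree = 0 := Polynomial.natDegree_ofNat 2
      omega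
    have hRbnd : ∀ u ∈ Set.Icc (-1 : ℝ) 1, |R.eval u| ≤ 1 := by
      intro u hu
      have h := hp (1 / 2 * (1 - u)) ⟨by linarith [hu.2], by linarith [hu.1]⟩
      have hR : R.eval u = s * (2 * p.eval (1 / 2 * (1 - u)) - 1) := by
        simp [R, ℓ, Polynomial.eval_comp]
      rw [hR, abs_mul, hs, one_mul, abs_le]
      constructor <;> linarith [h.1, h.2]
    have h := Polynomial.Chebyshev.eval_iterate_derivative_le_of_forall_abs_le_one
      (k := 1) le_rfl hRdeg hRbnd
    have hR' : R.derivative.eval 1 = -s * p.derivative.eval 0 := by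
      simp [R, ℓ, Polynomial.derivative_comp, Polynomial.eval_comp]
    simpa [hR', Polynomial.Chebyshev.derivative_T_eval_one] using h
  rw [abs_le]
  constructor
  · linarith [key 1 (by simp)]
  · linarith [key (-1) (by simp)]

/-- The derivative at `0` of the Bernstein-type polynomial with coefficient `g S` at
`X ^ #S * (1 - X) ^ (b - #S)`. -/
lemma derivative_eval_zero_sum_powerset {b : ℕ} (g : Finset (Fin b) → ℝ) :
    (∑ S : Finset (Fin b), Polynomial.C (g S) *
      (Polynomial.X ^ #S * (1 - Polynomial.X) ^ (b - #S))).derivative.eval 0 =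
      ∑ j, (g {j} - g ∅) := by
  have hterm : ∀ S : Finset (Fin b), (Polynomial.C (g S) *
      (Polynomial.X ^ #S * (1 - Polynomial.X) ^ (b - #S))).derivative.eval 0 =
      (if S = ∅ then -(b : ℝ) * g ∅ else 0) + if #S = 1 then g S else 0 := by
    intro S
    rcases S.eq_empty_or_nonempty with rfl | hS
    · simp [Polynomial.derivative_pow]
      ring
    · have hS0 : #S ≠ 0 := hS.card_ne_zero
      by_cases h1 : #S = 1
      · simp [h1, hS.ne_empty]
      · have h2 : #S - 1 ≠ 0 := by omega
        simp [h1, hS.ne_empty, hS0, h2, Polynomial.derivative_pow]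
  rw [Polynomial.derivative_sum, Polynomial.eval_finsetSum, sum_congr rfl fun S _ => hterm S,
    sum_add_distrib, ← sum_filter (fun S : Finset (Fin b) => #S = 1)]
  have himg : (univ.filter fun S : Finset (Fin b) => #S = 1) =
      univ.image fun j : Fin b => ({j} : Finset (Fin b)) := by
    ext S
    simp [card_eq_one, eq_comm]
  rw [himg, sum_image fun i _ j _ h => singleton_injective h]
  simp
  ring

lemma bval_mem_Icc (c : Bool) : bval c ∈ Set.Icc (0 : ℝ) 1 := by
  cases c <;> simp [bval]

/-- Flipping each of the disjoint blocks `B j` independently with probability `X` gives an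
expectation which is a polynomial of degree at most the total degree of `P`. -/
lemma natDegree_sum_flipB_le {n b : ℕ} (P : MvPolynomial (Fin n) ℝ) (x : Fin n → Bool)
    (B : Fin b → Finset (Fin n)) (hB : ∀ j k, j ≠ k → Disjoint (B j) (B k)) :
    (∑ S : Finset (Fin b),
      Polynomial.C (MvPolynomial.eval (fun i => bval (flipB x (S.biUnion B) i)) P) *
      (Polynomial.X ^ #S * (1 - Polynomial.X) ^ (b - #S))).natDegree ≤ P.totalDegree := by
  let U : Finset (Fin n) := univ.biUnion B
  let K : (Fin n →₀ ℕ) → ℝ := fun m => P.coeff m * ∏ i ∈ Uᶜ, bval (x i) ^ m i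
  let a : (Fin n →₀ ℕ) → Fin b → ℝ := fun m j => ∏ i ∈ B j, bval (x i) ^ m i
  let c : (Fin n →₀ ℕ) → Fin b → ℝ := fun m j => ∏ i ∈ B j, bval (!x i) ^ m i
  have heval : ∀ S : Finset (Fin b),
      MvPolynomial.eval (fun i => bval (flipB x (S.biUnion B) i)) P =
      ∑ m ∈ P.support, K m * ((∏ j ∈ S, c m j) * ∏ j ∈ univ \ S, a m j) := by
    intro S
    rw [MvPolynomial.eval_eq']
    refine sum_congr rfl fun m _ => ?_
    rw [mul_assoc, ← prod_compl_mul_prod U,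
      show ∏ i ∈ U, bval (flipB x (S.biUnion B) i) ^ m i =
        ∏ j, ∏ i ∈ B j, bval (flipB x (S.biUnion B) i) ^ m i from
        prod_biUnion fun j _ k _ hjk => hB j k hjk,
      ← prod_sdiff (subset_univ S), mul_comm (∏ j ∈ univ \ S, _)]
    congr 2
    · refine prod_congr rfl fun i hi => ?_
      have : i ∉ S.biUnion B := fun h =>
        mem_compl.1 hi (biUnion_subset_biUnion_of_subset_left B (subset_univ S) h)
      simp only [flipB, if_neg this]
    · congr 1
      · refine prod_congr rfl fun j hj => prod_congr rfl fun i hi => ?_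
        have : i ∈ S.biUnion B := mem_biUnion.2 ⟨j, hj, hi⟩
        simp only [flipB, if_pos this]
      · refine prod_congr rfl fun j hj => prod_congr rfl fun i hi => ?_
        have : i ∉ S.biUnion B := by
          intro h
          obtain ⟨k, hk, hik⟩ := mem_biUnion.1 h
          have hkj : k ≠ j := by
            rintro rfl
            exact (mem_sdiff.1 hj).2 hk
          exact disjoint_left.1 (hB k j hkj) hik hi
        simp only [flipB, if_neg this]
  have hsum : (∑ S : Finset (Fin b),
      Polynomial.C (MvPolynomial.eval (fun i => bval (flipB x (S.biUnion B) i)) P) *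
      (Polynomial.X ^ #S * (1 - Polynomial.X) ^ (b - #S))) =
      ∑ m ∈ P.support, Polynomial.C (K m) *
        ∏ j, (Polynomial.C (c m j) * Polynomial.X +
          Polynomial.C (a m j) * (1 - Polynomial.X)) := by
    simp_rw [heval, prod_add, map_sum, sum_mul, powerset_univ, mul_sum]
    rw [sum_comm]
    refine sum_congr rfl fun m _ => sum_congr rfl fun S _ => ?_
    rw [prod_mul_distrib, prod_mul_distrib, prod_const, prod_const,
      card_sdiff_of_subset (subset_univ S)]
    simp only [map_mul, map_prod, card_univ, Fintype.card_fin]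
    ring
  rw [hsum]
  refine Polynomial.natDegree_sum_le_of_forall_le _ _ fun m hm => ?_
  refine (Polynomial.natDegree_C_mul_le _ _).trans ?_
  refine (Polynomial.natDegree_prod_le _ _).trans ?_
  calc ∑ j, (Polynomial.C (c m j) * Polynomial.X +
          Polynomial.C (a m j) * (1 - Polynomial.X)).natDegree
      ≤ ∑ j, ∑ i ∈ B j, m i := by
        refine sum_le_sum fun j _ => ?_
        by_cases h0 : ∑ i ∈ B j, m i = 0
        · have hz : ∀ i ∈ B j, m i = 0 := sum_eq_zero_iff.1 h0
          have ha : a m j = 1 := prod_eq_one fun i hi => by rw [hz i hi, pow_zero]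
          have hc : c m j = 1 := prod_eq_one fun i hi => by rw [hz i hi, pow_zero]
          simp [ha, hc]
        · refine le_trans ?_ (Nat.one_le_iff_ne_zero.2 h0)
          refine Polynomial.natDegree_add_le_of_degree_le ?_ ?_
          · exact (Polynomial.natDegree_C_mul_le _ _).trans Polynomial.natDegree_X_le
          · refine (Polynomial.natDegree_C_mul_le _ _).trans ?_
            exact (Polynomial.natDegree_sub_le _ _).trans (by simp)
    _ = ∑ i ∈ U, m i := (sum_biUnion fun j _ k _ hjk => hB j k hjk).symm
    _ ≤ ∑ i, m i := sum_le_sum_of_subset (subset_univ U)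
    _ = m.sum fun _ e => e := (m.sum_fintype (fun _ e => e) fun _ => rfl).symm
    _ ≤ P.totalDegree := MvPolynomial.le_totalDegree hm

/-- Any family of disjoint sensitive blocks has size at most `deg(f)^2`. -/
lemma HasSensBlocks.le_totalDegree_sq {n b : ℕ} {f : (Fin n → Bool) → Bool}
    (h : HasSensBlocks f b) {P : MvPolynomial (Fin n) ℝ} (hP : Represents P f) :
    b ≤ P.totalDegree ^ 2 := by
  obtain ⟨x, B, hB, hsens⟩ := h
  let g : Finset (Fin b) → ℝ := fun S => bval (f (flipB x (S.biUnion B)))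
  let p : Polynomial ℝ := ∑ S : Finset (Fin b),
    Polynomial.C (g S) * (Polynomial.X ^ #S * (1 - Polynomial.X) ^ (b - #S))
  have hdeg : p.natDegree ≤ P.totalDegree := by
    simpa only [hP.2] using natDegree_sum_flipB_le P x B hB
  have hbnd : ∀ t ∈ Set.Icc (0 : ℝ) 1, p.eval t ∈ Set.Icc (0 : ℝ) 1 := by
    intro t ht
    have hw : ∀ S : Finset (Fin b), 0 ≤ t ^ #S * (1 - t) ^ (b - #S) := fun S =>
      mul_nonneg (pow_nonneg ht.1 _) (pow_nonneg (by linarith [ht.2]) _)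
    have hone : ∑ S : Finset (Fin b), t ^ #S * (1 - t) ^ (b - #S) = 1 := by
      simpa using Fintype.sum_pow_mul_eq_add_pow (Fin b) t (1 - t)
    have hev : p.eval t = ∑ S, g S * (t ^ #S * (1 - t) ^ (b - #S)) := by
      simp [p, Polynomial.eval_finsetSum]
    rw [hev]
    refine ⟨sum_nonneg fun S _ => mul_nonneg (bval_mem_Icc _).1 (hw S), ?_⟩
    refine le_of_le_of_eq ?_ hone
    exact sum_le_sum fun S _ => mul_le_of_le_one_left (hw S) (bval_mem_Icc _).2
  have hmarkov := abs_derivative_eval_zero_le hdeg hbnd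
  have hempty : g ∅ = bval (f x) := by
    have hflip : flipB x ∅ = x := by
      ext i
      simp [flipB]
    simp [g, hflip]
  have hderiv : |p.derivative.eval 0| = b := by
    rw [derivative_eval_zero_sum_powerset g]
    have hj : ∀ j, g {j} - g ∅ = 1 - 2 * bval (f x) := by
      intro j
      have hne := hsens j
      rw [hempty]
      simp only [g, singleton_biUnion]
      cases h1 : f (flipB x (B j)) <;> cases h2 : f x <;> simp_all [bval]
      norm_num
    rw [sum_congr rfl fun j _ => hj j]
    cases f x <;> norm_num [bval]
  rw [hderiv] at hmarkov
  exact_mod_cast hmarkov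

/-- `bs(f) ≤ 2·deg(f)^2` for every Boolean function `f`. -/
theorem stmt_15 {n : ℕ} (f : (Fin n → Bool) → Bool) (P : MvPolynomial (Fin n) ℝ)
    (hP : Represents P f) :
    bs f ≤ 2 * P.totalDegree ^ 2 := by
  refine csSup_le ⟨0, fun _ => false, Fin.elim0, fun j => j.elim0, fun j => j.elim0⟩ ?_
  intro b hb
  have hle : b ≤ P.totalDegree ^ 2 := HasSensBlocks.le_totalDegree_sq hb hP
  omega
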